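/- arXiv:2508.02828 — 4 statements merged into one kernel-verified Lean document; each statement's English description precedes it below -/
import Mathlib

section
/- (Gabay–O'Connor) There exists a strategy for the hat-guessing game with countably many players and two hat colors under which, for every possible hat assignment, all but finitely many players guess their own hat color correctly: there exist functions f_i : {0,1}^ℕ → {0,1} (i ∈ ℕ), each satisfying f_i(ω) = f_i(ω') whenever ω_j = ω'_j for all j ≠ i, such that for every ξ ∈ {0,1}^ℕ the set {i ∈ ℕ : f_i(ξ) ≠ ξ_i} is finite. -/
/-- **Gabay–O'Connor.** There is a strategy for the hat-guessing game with
countably many players and two hat colors under which, for every hat assignment, all but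
finitely many players guess their own hat color correctly. -/
theorem gabay_oconnor :
    ∃ f : ℕ → (ℕ → Fin 2) → Fin 2,
      (∀ i, ∀ ω ω' : ℕ → Fin 2, (∀ j, j ≠ i → ω j = ω' j) → f i ω = f i ω') ∧
      ∀ ξ : ℕ → Fin 2, {i : ℕ | f i ξ ≠ ξ i}.Finite := by
  let s : Setoid (ℕ → Fin 2) :=
    { r := fun a b => {i : ℕ | a i ≠ b i}.Finite
      iseqv :=
        { refl := fun a => by simp
          symm := fun {a b} h => h.subset (fun i hi => Ne.symm hi)
          trans := fun {a b c} h h' => (h.union h').subset (fun i hi => by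
            by_contra hc
            simp only [Set.mem_union, Set.mem_setOf_eq, not_or, not_not] at hc
            exact hi (hc.1.trans hc.2)) } }
  refine ⟨fun i ω => (Quotient.mk s ω).out i, ?_, ?_⟩
  · intro i ω ω' h
    have hq : Quotient.mk s ω = Quotient.mk s ω' := by
      apply Quotient.sound
      change {j : ℕ | ω j ≠ ω' j}.Finite
      refine (Set.finite_singleton i).subset (fun j hj => ?_)
      by_contra hne
      exact hj (h j hne)
    simp only [hq]
  · intro ξ
    exact Quotient.mk_out (s := s) ξ
end

section
/- (Gabay–O'Connor, general form) For any set I of players and any nonempty set C of hat colors, there exists a strategy under which, for every hat assignment, all but finitely many players guess correctly: there exist functions f_i : C^I → C (i ∈ I), each satisfying f_i(ω) = f_i(ω') whenever ω_j = ω'_j for all j ≠ i, such that for every ξ ∈ C^I the set {i ∈ I : f_i(ξ) ≠ ξ_i} is finite. -/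
/-- **Gabay–O'Connor, general form.** For an arbitrary set `I` of players
and an arbitrary nonempty set `C` of hat colors, there is a strategy under which, for
every hat assignment, all but finitely many players guess correctly. -/
theorem gabay_oconnor_general (I : Type*) (C : Type*) [Nonempty C] :
    ∃ f : I → (I → C) → C,
      (∀ i, ∀ ω ω' : I → C, (∀ j, j ≠ i → ω j = ω' j) → f i ω = f i ω') ∧
      ∀ ξ : I → C, {i : I | f i ξ ≠ ξ i}.Finite := by
  let S : Setoid (I → C) :=
    { r := fun a b => {i : I | a i ≠ b i}.Finite
      iseqv :=
        { refl := fun a => by simp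
          symm := fun {a b} h => h.subset (fun i hi => Ne.symm hi)
          trans := fun {a b c} h1 h2 => (h1.union h2).subset (fun i hi => by
            by_contra hn
            simp only [Set.mem_union, Set.mem_setOf_eq, not_or, not_not] at hn hi
            exact hi (hn.1.trans hn.2)) } }
  refine ⟨fun i ω => (Quotient.mk S ω).out i, ?_, ?_⟩
  · intro i ω ω' h
    have hq : Quotient.mk S ω = Quotient.mk S ω' := by
      apply Quotient.sound
      refine (Set.finite_singleton i).subset (fun j hj => ?_)
      by_contra hn
      exact hj (h j hn)
    simp only [hq]
  · intro ξ
    exact Quotient.mk_out (s := S) ξ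
end

section
/- No strategy in the infinite hat-guessing game can guarantee a bounded number of incorrect guesses: for every strategy (f_i)_{i∈ℕ} and every n ≥ 1, there exists a hat assignment ξ ∈ {0,1}^ℕ with ξ_i = 0 for all i > n such that at least n/2 of the players 1,…,n guess incorrectly, i.e. |{i ≤ n : f_i(ξ) ≠ ξ_i}| ≥ n/2. -/
/-- The assignment giving color `1` exactly to the players in `S`. -/
def hatOf (S : Finset ℕ) : ℕ → Fin 2 := fun j => if j ∈ S then 1 else 0

theorem hat_half (f : ℕ → (ℕ → Fin 2) → Fin 2)
    (hf : ∀ i, ∀ ω ω' : ℕ → Fin 2, (∀ j, j ≠ i → ω j = ω' j) → f i ω = f i ω')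
    (n i : ℕ) (hi : i ∈ Finset.Icc 1 n) :
    2 * ∑ S ∈ (Finset.Icc 1 n).powerset, (if f i (hatOf S) ≠ hatOf S i then 1 else 0)
      = (Finset.Icc 1 n).powerset.card := by
  have hmem : ∀ S ∈ (Finset.Icc 1 n).powerset, symmDiff S {i} ∈ (Finset.Icc 1 n).powerset := by
    intro S hS
    rw [Finset.mem_powerset] at hS ⊢
    intro j hj
    rw [Finset.mem_symmDiff] at hj
    rcases hj with ⟨h, _⟩ | ⟨h, _⟩
    · exact hS h
    · rw [Finset.mem_singleton] at h
      exact h ▸ hi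
  have hinv : ∀ S : Finset ℕ, symmDiff (symmDiff S {i}) {i} = S := fun S =>
    symmDiff_symmDiff_cancel_right _ _
  have h2 : ∑ S ∈ (Finset.Icc 1 n).powerset, (if f i (hatOf S) ≠ hatOf S i then 1 else 0)
      = ∑ S ∈ (Finset.Icc 1 n).powerset,
        (if f i (hatOf (symmDiff S {i})) ≠ hatOf (symmDiff S {i}) i then 1 else 0) := by
    refine Finset.sum_nbij' (fun S => symmDiff S {i}) (fun S => symmDiff S {i}) hmem hmem
      (fun S _ => hinv S) (fun S _ => hinv S) ?_
    intro S _
    simp only [hinv]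
  rw [two_mul]
  nth_rewrite 2 [h2]
  rw [← Finset.sum_add_distrib, Finset.card_eq_sum_ones]
  refine Finset.sum_congr rfl fun S _ => ?_
  have h3 : f i (hatOf (symmDiff S {i})) = f i (hatOf S) := by
    apply hf
    intro j hj
    simp [hatOf, Finset.mem_symmDiff, hj]
  rw [h3]
  generalize f i (hatOf S) = c
  by_cases h : i ∈ S <;> simp only [hatOf, Finset.mem_symmDiff, h, Finset.mem_singleton] <;>
    fin_cases c <;> simp

/-- No strategy in the infinite hat-guessing game guarantees a bounded
number of incorrect guesses: for every strategy and every `n ≥ 1` there is a hat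
assignment, giving black hats (color `0`) to all players beyond the `n`-th, on which at
least `n/2` of the players `1, …, n` guess incorrectly. -/
theorem hat_game_no_bounded_error (f : ℕ → (ℕ → Fin 2) → Fin 2)
    (hf : ∀ i, ∀ ω ω' : ℕ → Fin 2, (∀ j, j ≠ i → ω j = ω' j) → f i ω = f i ω')
    (n : ℕ) (hn : 1 ≤ n) :
    ∃ ξ : ℕ → Fin 2, (∀ i, n < i → ξ i = 0) ∧
      (n : ℝ) / 2 ≤ ((Finset.Icc 1 n).filter fun i => f i ξ ≠ ξ i).card := by
  have key : ∃ S ∈ (Finset.Icc 1 n).powerset,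
      n ≤ 2 * ((Finset.Icc 1 n).filter fun i => f i (hatOf S) ≠ hatOf S i).card := by
    apply Finset.exists_le_of_sum_le ⟨∅, by simp⟩
    apply le_of_eq
    simp only [Finset.card_filter]
    rw [← Finset.mul_sum, Finset.sum_comm, Finset.mul_sum,
      Finset.sum_congr rfl (fun i hi => hat_half f hf n i hi)]
    simp [mul_comm]
  obtain ⟨S, hS, h⟩ := key
  refine ⟨hatOf S, ?_, ?_⟩
  · intro i hi
    have : i ∉ S := fun h' => by
      have := Finset.mem_Icc.1 (Finset.mem_powerset.1 hS h')
      omega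
    simp [hatOf, this]
  · have h' : (n : ℝ) ≤ 2 * (((Finset.Icc 1 n).filter
        fun i => f i (hatOf S) ≠ hatOf S i).card : ℝ) := by exact_mod_cast h
    linarith
end

section
/- (Lenstra) There exists a strategy for the hat-guessing game with countably many players and two hat colors under which, for every possible hat assignment, either all players guess correctly or all players guess incorrectly: there exist functions f_i : {0,1}^ℕ → {0,1} (i ∈ ℕ), each satisfying f_i(ω) = f_i(ω') whenever ω_j = ω'_j for all j ≠ i, such that for every ξ ∈ {0,1}^ℕ, either f_i(ξ) = ξ_i for all i, or f_i(ξ) ≠ ξ_i for all i. -/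
theorem exists_parity : ∃ P : (ℕ → ZMod 2) →ₗ[ZMod 2] ZMod 2, ∀ i, P (Pi.single i 1) = 1 := by
  have : Fact (Nat.Prime 2) := ⟨Nat.prime_two⟩
  obtain ⟨g, hg⟩ := LinearMap.exists_leftInverse_of_injective
    (Finsupp.lcoeFun : (ℕ →₀ ZMod 2) →ₗ[ZMod 2] (ℕ → ZMod 2))
    (LinearMap.ker_eq_bot.2 DFunLike.coe_injective)
  refine ⟨(Finsupp.linearCombination (ZMod 2) (fun _ : ℕ => (1 : ZMod 2))).comp g, fun i => ?_⟩
  have h := LinearMap.congr_fun hg (Finsupp.single i 1)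
  have e : ((Finsupp.lcoeFun : (ℕ →₀ ZMod 2) →ₗ[ZMod 2] (ℕ → ZMod 2)) (Finsupp.single i (1 : ZMod 2))) = Pi.single i 1 := by
    ext j
    simp [Finsupp.lcoeFun, Finsupp.single_eq_pi_single]
  rw [LinearMap.comp_apply, e] at h
  rw [LinearMap.comp_apply, h]
  simp

theorem lenstra_zmod :
    ∃ f : ℕ → (ℕ → ZMod 2) → ZMod 2,
      (∀ i, ∀ ω ω' : ℕ → ZMod 2, (∀ j, j ≠ i → ω j = ω' j) → f i ω = f i ω') ∧
      ∀ ξ : ℕ → ZMod 2, (∀ i, f i ξ = ξ i) ∨ (∀ i, f i ξ ≠ ξ i) := by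
  obtain ⟨P, hP⟩ := exists_parity
  refine ⟨fun i ω => P (Function.update ω i 0), fun i ω ω' h => ?_, fun ξ => ?_⟩
  · have : Function.update ω i 0 = Function.update ω' i 0 := by
      ext j
      by_cases hj : j = i
      · subst hj; simp
      · simp [hj, h j hj]
    simp only [this]
  · have key : ∀ i, P ξ = P (Function.update ξ i 0) + ξ i := by
      intro i
      have : ξ = Function.update ξ i 0 + ξ i • Pi.single i (1 : ZMod 2) := by
        ext j
        by_cases hj : j = i
        · subst hj; simp
        · simp [hj]
      conv_lhs => rw [this]
      rw [map_add, map_smul, hP]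
      simp
    have d : ∀ p a b : ZMod 2, p = a + b → (p = 0 ↔ a = b) := by decide
    by_cases h : P ξ = 0
    · exact Or.inl fun i => (d _ _ _ (key i)).1 h
    · exact Or.inr fun i e => h ((d _ _ _ (key i)).2 e)

/-- **Lenstra.** There is a strategy for the hat-guessing game with
countably many players and two hat colors under which, for every hat assignment, either
all players guess correctly or all players guess incorrectly. -/
theorem lenstra_strategy :
    ∃ f : ℕ → (ℕ → Fin 2) → Fin 2,
      (∀ i, ∀ ω ω' : ℕ → Fin 2, (∀ j, j ≠ i → ω j = ω' j) → f i ω = f i ω') ∧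
      ∀ ξ : ℕ → Fin 2, (∀ i, f i ξ = ξ i) ∨ (∀ i, f i ξ ≠ ξ i) := by
  exact lenstra_zmod
end
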